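/- Define the canonical structure M^c whose worlds are finite multisets of formulas, with Γ ∘^c Δ = Γ ⊔ Δ (multiset union), e^c = ∅, Γ ≥^c Δ iff the sequent Γ ⊢ Δ* is derivable (where Δ* is the tensor of all formulas in Δ, with ∅* = 1). Then (M^c, e^c, ∘^c, ≥^c) is a preordered commutative monoid satisfying bifunctoriality: ≥^c is reflexive and transitive, and Γ ≥^c Δ and Γ' ≥^c Δ' imply Γ ⊔ Γ' ≥^c Δ ⊔ Δ'. -/

import Mathlib

/-- Formulas of modal intuitionistic linear logic (MILL): atoms, 1, ⊗, &, ⊸, □. -/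
inductive Fm : Type where
  | atom : ℕ → Fm
  | one : Fm
  | tensor : Fm → Fm → Fm
  | and : Fm → Fm → Fm
  | limp : Fm → Fm → Fm
  | box : Fm → Fm

/-- Raw data of a modal Kripke resource frame/model. -/
structure KFrame where
  W : Type
  e : W
  mul : W → W → W
  ge : W → W → Prop
  N : W → Set (Set W)
  V : ℕ → Set W

/-- Truth at a world of a modal Kripke resource model. -/
def sat (F : KFrame) : F.W → Fm → Prop
  | m, .atom p => m ∈ F.V p
  | m, .one => F.ge m F.e
  | m, .tensor A B => ∃ m1 m2, F.ge m (F.mul m1 m2) ∧ sat F m1 A ∧ sat F m2 B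
  | m, .and A B => sat F m A ∧ sat F m B
  | m, .limp A B => ∀ n, sat F n A → sat F (F.mul n m) B
  | m, .box A => {n | sat F n A} ∈ F.N m

/-- The axioms making the data a modal Kripke resource model:
commutative monoid, preorder, bifunctoriality, hereditary valuation,
and heredity of the neighbourhood function. -/
def IsMKRM (F : KFrame) : Prop :=
  (∀ a b, F.mul a b = F.mul b a) ∧
  (∀ a b c, F.mul (F.mul a b) c = F.mul a (F.mul b c)) ∧
  (∀ a, F.mul a F.e = a) ∧
  (∀ a, F.ge a a) ∧
  (∀ a b c, F.ge a b → F.ge b c → F.ge a c) ∧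
  (∀ m n m' n', F.ge m n → F.ge m' n' → F.ge (F.mul m m') (F.mul n n')) ∧
  (∀ p m n, m ∈ F.V p → F.ge n m → n ∈ F.V p) ∧
  (∀ X m n, X ∈ F.N m → F.ge n m → X ∈ F.N n)

/-- The MILL sequent calculus over multisets of formulas. -/
inductive Der : Multiset Fm → Fm → Prop where
  | ax (A : Fm) : Der {A} A
  | cut {Γ Γ' : Multiset Fm} {A C : Fm} :
      Der (A ::ₘ Γ) C → Der Γ' A → Der (Γ + Γ') C
  | tensorL {Γ : Multiset Fm} {A B C : Fm} :
      Der (A ::ₘ B ::ₘ Γ) C → Der (Fm.tensor A B ::ₘ Γ) C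
  | tensorR {Γ Γ' : Multiset Fm} {A B : Fm} :
      Der Γ A → Der Γ' B → Der (Γ + Γ') (Fm.tensor A B)
  | limpL {Γ Γ' : Multiset Fm} {A B C : Fm} :
      Der Γ A → Der (B ::ₘ Γ') C → Der (Fm.limp A B ::ₘ (Γ + Γ')) C
  | limpR {Γ : Multiset Fm} {A B : Fm} :
      Der (A ::ₘ Γ) B → Der Γ (Fm.limp A B)
  | andL1 {Γ : Multiset Fm} {A B C : Fm} :
      Der (A ::ₘ Γ) C → Der (Fm.and A B ::ₘ Γ) C
  | andL2 {Γ : Multiset Fm} {A B C : Fm} :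
      Der (B ::ₘ Γ) C → Der (Fm.and A B ::ₘ Γ) C
  | andR {Γ : Multiset Fm} {A B : Fm} :
      Der Γ A → Der Γ B → Der Γ (Fm.and A B)
  | oneL {Γ : Multiset Fm} {C : Fm} :
      Der Γ C → Der (Fm.one ::ₘ Γ) C
  | oneR : Der 0 Fm.one
  | boxRe {A B : Fm} :
      Der {A} B → Der {B} A → Der {Fm.box A} (Fm.box B)

/-- Tensor of a list of formulas (empty list ↦ 1, singleton ↦ the formula). -/
def listStar : List Fm → Fm
  | [] => Fm.one
  | [A] => A
  | A :: l => Fm.tensor A (listStar l)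

/-- Γ*: the tensor of all the formulas in the multiset Γ, with ∅* = 1. -/
noncomputable def star (Γ : Multiset Fm) : Fm := listStar Γ.toList

/-- Canonical order: Γ ≥^c Δ iff Γ ⊢ Δ* is derivable. -/
noncomputable def geC (Γ Δ : Multiset Fm) : Prop := Der Γ (star Δ)

theorem Der.listStar_right : ∀ l : List Fm, Der (l : Multiset Fm) (listStar l)
  | [] => Der.oneR
  | [A] => Der.ax A
  | A :: B :: l => Der.tensorR (Der.ax A) (Der.listStar_right (B :: l))

theorem Der.listStar_left {C : Fm} :
    ∀ (l : List Fm) {Γ : Multiset Fm}, Der ((l : Multiset Fm) + Γ) C → Der (listStar l ::ₘ Γ) C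
  | [], Γ, h => Der.oneL (by simpa using h)
  | [A], Γ, h => by
    rwa [Multiset.coe_singleton, Multiset.singleton_add] at h
  | A :: B :: l, Γ, h => by
    refine Der.tensorL ?_
    rw [Multiset.cons_swap]
    refine Der.listStar_left (B :: l) ?_
    rwa [Multiset.add_cons, ← Multiset.cons_add, Multiset.cons_coe]

theorem Der.star_right (Γ : Multiset Fm) : Der Γ (star Γ) := by
  simpa [_root_.star] using Der.listStar_right Γ.toList

/-- Cut against all the formulas of a multiset at once. -/
theorem Der.cut_star {Γ Γ' Δ : Multiset Fm} {C : Fm}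
    (h : Der (Δ + Γ) C) (h' : Der Γ' (star Δ)) : Der (Γ + Γ') C :=
  Der.cut (Der.listStar_left Δ.toList (by rwa [Multiset.coe_toList])) h'

/-- (M^c, e^c, ∘^c, ≥^c) — finite multisets with multiset union,
empty multiset, and ≥^c — is a preordered commutative monoid satisfying
bifunctoriality: ≥^c is reflexive, transitive, and bifunctorial. -/
theorem canonical_frame_monoid :
    (∀ Γ : Multiset Fm, geC Γ Γ) ∧
    (∀ Γ Δ Θ : Multiset Fm, geC Γ Δ → geC Δ Θ → geC Γ Θ) ∧
    (∀ Γ Δ Γ' Δ' : Multiset Fm, geC Γ Δ → geC Γ' Δ' → geC (Γ + Γ') (Δ + Δ')) := by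
  refine ⟨Der.star_right, fun Γ Δ Θ h h' => ?_, fun Γ Δ Γ' Δ' h h' => ?_⟩
  · have hΘ : Der (Δ + 0) (star Θ) := by rwa [add_zero]
    simpa [geC] using hΘ.cut_star h
  · exact ((Der.star_right (Δ + Δ')).cut_star h).cut_star h'
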